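/- Let (R, m) be a local regular domain, let x ∈ m \ m², and set S = R[m/x]. Then for every k ∈ ℕ, x^k S ∩ R = m^k S ∩ R = m^k. -/

import Mathlib

set_option synthInstance.maxHeartbeats 1000000
set_option maxHeartbeats 2000000

open IsLocalRing

noncomputable section

/-- The ideal generated by the nonunits of a ring (the maximal ideal, if the ring is local). -/
def nuIdeal (A : Type*) [CommRing A] : Ideal A := Ideal.span {a : A | ¬ IsUnit a}

/-- A commutative ring is regular local if it is a Noetherian local ring whose maximal ideal
can be generated by `dim` elements. -/
def IsRegLoc (A : Type*) [CommRing A] : Prop :=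
  IsLocalRing A ∧ IsNoetherianRing A ∧
    ∃ s : Finset A, (Ideal.span (s : Set A) = nuIdeal A) ∧
      ((s.card : ℕ) : WithBot (WithTop ℕ)) = ringKrullDim A

lemma sup_pow_succ_eq {R : Type*} [CommRing R] (I K : Ideal R) (j : ℕ) :
    (I ⊔ K) ^ (j + 1) = I * (I ⊔ K) ^ j ⊔ K ^ (j + 1) := by
  induction j with
  | zero => simp
  | succ j ih =>
    refine le_antisymm ?_ (sup_le ?_ (Ideal.pow_right_mono le_sup_right _))
    · rw [pow_succ' _ (j + 1), Ideal.sup_mul]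
      refine sup_le le_sup_left ?_
      conv_lhs => rw [ih]
      rw [Ideal.mul_sup, ← pow_succ', ← mul_assoc, mul_comm K I, mul_assoc]
      refine sup_le_sup_right (Ideal.mul_mono_right ?_) _
      rw [pow_succ' _ j]
      exact Ideal.mul_mono_left le_sup_right
    · rw [pow_succ' _ (j + 1)]
      exact Ideal.mul_mono_left le_sup_left

/-- If every `x ∈ s` is a nonzerodivisor modulo each ideal generated by a subset of `s` not
containing `x`, then it is also a nonzerodivisor modulo the powers of such ideals. -/
lemma mem_span_pow_sup_of_mul_mem {R : Type*} [CommRing R] [DecidableEq R] (s : Finset R)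
    (hs : ∀ A ⊆ s, ∀ x ∈ s, x ∉ A → ∀ a, x * a ∈ Ideal.span (A : Set R) →
      a ∈ Ideal.span (A : Set R))
    (Y : Finset R) (hY : Y ⊆ s) :
    ∀ A ⊆ s, Disjoint Y A → ∀ x ∈ s, x ∉ A → x ∉ Y → ∀ (j : ℕ) (a : R),
      x * a ∈ Ideal.span (Y : Set R) ^ j ⊔ Ideal.span (A : Set R) →
      a ∈ Ideal.span (Y : Set R) ^ j ⊔ Ideal.span (A : Set R) := by
  induction Y using Finset.induction_on with
  | empty =>
    intro A hA _ x hx hxA _ j a h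
    rcases j with _ | j
    · simp
    · simp only [Finset.coe_empty, Ideal.span_empty, pow_succ, Ideal.mul_bot, bot_sup_eq] at h ⊢
      exact hs A hA x hx hxA a h
  | insert y Y hyY ih =>
    intro A hA hdis x hx hxA hxY j
    have hys : y ∈ s := hY (Finset.mem_insert_self _ _)
    have hYs : Y ⊆ s := (Finset.subset_insert _ _).trans hY
    rw [Finset.disjoint_insert_left] at hdis
    have hspan : Ideal.span ((insert y Y : Finset R) : Set R) =
        Ideal.span {y} ⊔ Ideal.span (Y : Set R) := by
      rw [Finset.coe_insert, Ideal.span_insert]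
    rw [Finset.mem_insert, not_or] at hxY
    rw [hspan]
    induction j with
    | zero => intro a _; simp
    | succ j ihj =>
      intro a h
      set P := Ideal.span {y} ⊔ Ideal.span (Y : Set R) with hP
      set K := Ideal.span (Y : Set R) with hK
      set L := Ideal.span (A : Set R) with hL
      have hpow : P ^ (j + 1) = Ideal.span {y} * P ^ j ⊔ K ^ (j + 1) :=
        sup_pow_succ_eq _ _ _
      have hKP : K ^ (j + 1) ≤ P ^ (j + 1) := Ideal.pow_right_mono le_sup_right _
      have h1 : a ∈ K ^ (j + 1) ⊔ Ideal.span ((insert y A : Finset R) : Set R) := by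
        refine ih hYs (insert y A) (Finset.insert_subset hys hA)
          (Finset.disjoint_insert_right.2 ⟨hyY, hdis.2⟩) x hx ?_ hxY.2 (j + 1) a ?_
        · rw [Finset.mem_insert, not_or]
          exact ⟨hxY.1, hxA⟩
        · rw [Finset.coe_insert, Ideal.span_insert]
          have h0 : Ideal.span {y} * P ^ j ≤ Ideal.span {y} := Ideal.mul_le_left
          have hle : P ^ (j + 1) ⊔ L ≤ K ^ (j + 1) ⊔ (Ideal.span {y} ⊔ L) := by
            rw [hpow, ← sup_assoc, sup_comm (K ^ (j + 1)) (Ideal.span {y})]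
            gcongr
          exact hle h
      rw [Finset.coe_insert, Ideal.span_insert] at h1
      obtain ⟨p, hp, q', hq', rfl⟩ := Submodule.mem_sup.1 h1
      obtain ⟨yb, hyb, q, hq, rfl⟩ := Submodule.mem_sup.1 hq'
      obtain ⟨b, rfl⟩ := Ideal.mem_span_singleton'.1 hyb
      have h2 : x * (b * y) ∈ P ^ (j + 1) ⊔ L := by
        have h3 : x * p + x * q ∈ P ^ (j + 1) ⊔ L :=
          add_mem (Ideal.mul_mem_left _ _ (Ideal.mem_sup_left (hKP hp)))
            (Ideal.mul_mem_left _ _ (Ideal.mem_sup_right hq))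
        have := sub_mem h h3
        convert this using 1
        ring
      rw [hpow, sup_assoc] at h2
      obtain ⟨ye, hye, c, hc, hsum⟩ := Submodule.mem_sup.1 h2
      obtain ⟨e, he, rfl⟩ := Ideal.mem_span_singleton_mul.1 hye
      have h4 : x * b - e ∈ K ^ (j + 1) ⊔ L := by
        refine ih hYs A hA hdis.2 y hys hdis.1 hyY (j + 1) _ ?_
        convert hc using 1
        linear_combination -hsum
      have h5 : b ∈ P ^ j ⊔ L := by
        refine ihj b ?_
        have h6 : x * b - e ∈ P ^ j ⊔ L :=
          sup_le_sup_right (hKP.trans (Ideal.pow_le_pow_right j.le_succ)) L h4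
        have := add_mem h6 (Ideal.mem_sup_left he)
        simpa using this
      refine add_mem (Ideal.mem_sup_left (hKP hp))
        (add_mem ?_ (Ideal.mem_sup_right hq))
      obtain ⟨u, hu, v, hv, rfl⟩ := Submodule.mem_sup.1 h5
      rw [add_mul]
      refine add_mem (Ideal.mem_sup_left ?_)
        (Ideal.mem_sup_right (Ideal.mul_mem_right _ _ hv))
      rw [pow_succ]
      exact Ideal.mul_mem_mul hu (Ideal.mem_sup_left (Ideal.mem_span_singleton_self y))

lemma nuIdeal_eq_maximalIdeal (R : Type*) [CommRing R] [IsLocalRing R] :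
    nuIdeal R = maximalIdeal R :=
  Ideal.span_eq (maximalIdeal R)

lemma ringKrullDim_le_card_of_span_eq_maximalIdeal {R : Type*} [CommRing R] [IsLocalRing R]
    [IsNoetherianRing R] (s : Finset R) (hs : Ideal.span (s : Set R) = maximalIdeal R) :
    ringKrullDim R ≤ s.card := by
  refine (ringKrullDim_le_spanFinrank_maximalIdeal R).trans ?_
  rw [← hs]
  have := Submodule.spanFinrank_span_le_ncard_of_finite (R := R) s.finite_toSet
  rw [Set.ncard_coe_finset] at this
  exact_mod_cast this

/-- An element of `m \ m²` can be exchanged into any finite generating set of `m`. -/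
lemma exists_span_insert_erase_eq_maximalIdeal {R : Type*} [CommRing R] [IsLocalRing R]
    [DecidableEq R] (s : Finset R) (hs : Ideal.span (s : Set R) = maximalIdeal R)
    (x : R) (hx : x ∈ maximalIdeal R) (hx2 : x ∉ maximalIdeal R ^ 2) :
    ∃ t ∈ s, Ideal.span ((insert x (s.erase t) : Finset R) : Set R) = maximalIdeal R := by
  have hsm : ∀ t ∈ s, t ∈ maximalIdeal R := fun t ht => hs ▸ Ideal.subset_span ht
  obtain ⟨f, -, hf⟩ := Submodule.mem_span_finset.1 (hs.symm ▸ hx : x ∈ Ideal.span (s : Set R))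
  simp only [smul_eq_mul] at hf
  have : ∃ t ∈ s, IsUnit (f t) := by
    by_contra! hcon
    refine hx2 (hf ▸ Ideal.sum_mem _ fun t ht => ?_)
    rw [pow_two]
    exact Ideal.mul_mem_mul ((mem_maximalIdeal _).2 (hcon t ht)) (hsm t ht)
  obtain ⟨t, ht, u, hu⟩ := this
  refine ⟨t, ht, le_antisymm ?_ ?_⟩
  · rw [Ideal.span_le]
    intro y hy
    rcases Finset.mem_insert.1 hy with rfl | hy
    · exact hx
    · exact hsm y (Finset.mem_of_mem_erase hy)
  · rw [← hs, Ideal.span_le]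
    intro y hy
    by_cases hyt : y = t
    · subst hyt
      rw [← Finset.add_sum_erase _ _ ht, ← hu] at hf
      have hy' : y = ↑u⁻¹ * (x - ∑ z ∈ s.erase y, f z * z) := by
        rw [← hf, add_sub_cancel_right, Units.inv_mul_cancel_left]
      suffices h : ↑u⁻¹ * (x - ∑ z ∈ s.erase y, f z * z) ∈
          Ideal.span ((insert x (s.erase y) : Finset R) : Set R) by
        rwa [← hy'] at h
      refine Ideal.mul_mem_left _ _ (sub_mem (Ideal.subset_span (by simp)) ?_)
      refine Ideal.sum_mem _ fun z hz => Ideal.mul_mem_left _ _ (Ideal.subset_span ?_)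
      exact Finset.mem_insert_of_mem hz
    · exact Ideal.subset_span (Finset.mem_insert_of_mem (Finset.mem_erase.2 ⟨hyt, hy⟩))

/-- The quotient by part of a regular system of parameters has the remaining elements as a
regular system of parameters. -/
lemma quotient_span_regular {R : Type*} [CommRing R] [IsLocalRing R]
    [IsNoetherianRing R] [DecidableEq R] (s A : Finset R) (hA : A ⊆ s)
    (hs : Ideal.span (s : Set R) = maximalIdeal R) (hd : (s.card : WithBot ℕ∞) ≤ ringKrullDim R)
    [DecidableEq (R ⧸ Ideal.span (A : Set R))] :
    ∃ _ : IsLocalRing (R ⧸ Ideal.span (A : Set R)),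
      Ideal.span (((s \ A).image (Ideal.Quotient.mk (Ideal.span (A : Set R))) : Finset _) :
        Set (R ⧸ Ideal.span (A : Set R))) = maximalIdeal (R ⧸ Ideal.span (A : Set R)) ∧
      ((s \ A).card : WithBot ℕ∞) ≤ ringKrullDim (R ⧸ Ideal.span (A : Set R)) := by
  have hAm : Ideal.span (A : Set R) ≤ maximalIdeal R :=
    hs ▸ Ideal.span_mono (Finset.coe_subset.2 hA)
  have hnt : Nontrivial (R ⧸ Ideal.span (A : Set R)) :=
    Ideal.Quotient.nontrivial_iff.2 (ne_top_of_le_ne_top Ideal.IsPrime.ne_top' hAm)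
  have hloc : IsLocalRing (R ⧸ Ideal.span (A : Set R)) :=
    IsLocalRing.of_surjective' _ Ideal.Quotient.mk_surjective
  refine ⟨hloc, ?_, ?_⟩
  · have hmap : (maximalIdeal R).map (Ideal.Quotient.mk (Ideal.span (A : Set R))) =
        maximalIdeal _ :=
      IsLocalRing.map_maximalIdeal_of_surjective _ Ideal.Quotient.mk_surjective
    rw [Finset.coe_image, ← Ideal.map_span, ← hmap, ← hs]
    have hun : (s : Set R) = (A : Set R) ∪ ((s \ A : Finset R) : Set R) := by
      rw [← Finset.coe_union, Finset.union_sdiff_of_subset hA]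
    conv_rhs => rw [hun, Ideal.span_union, Ideal.map_sup, Ideal.map_quotient_self, bot_sup_eq]
  · have h := ringKrullDim_le_ringKrullDim_quotient_add_card A (by
      rw [IsLocalRing.ringJacobson_eq_maximalIdeal]
      exact Ideal.span_le.1 hAm)
    have h2 := hd.trans h
    rw [← Finset.card_sdiff_add_card_eq_card hA] at h2
    push_cast at h2
    exact (ENat.WithBot.add_le_add_natCast_right_iff).1 h2

lemma isDomain_of_card_le_ringKrullDim (n : ℕ) : ∀ (R : Type*) [CommRing R] [IsLocalRing R]
    [IsNoetherianRing R] (s : Finset R), s.card ≤ n → Ideal.span (s : Set R) = maximalIdeal R →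
    (s.card : WithBot ℕ∞) ≤ ringKrullDim R → IsDomain R := by
  classical
  induction n with
  | zero =>
    intro R _ _ _ s hn hs hd
    rw [Nat.le_zero, Finset.card_eq_zero] at hn
    subst hn
    have : maximalIdeal R = ⊥ := by simpa using hs.symm
    exact (IsLocalRing.isField_iff_maximalIdeal_eq.2 this).isDomain
  | succ n ih =>
    intro R _ _ _ s hn hs hd
    by_cases hn' : s.card ≤ n
    · exact ih R s hn' hs hd
    have hpos : 0 < s.card := by omega
    have hdim : ringKrullDim R ≠ 0 := by
      intro h0
      rw [h0] at hd
      have : s.card ≤ 0 := by exact_mod_cast hd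
      omega
    have hnm : maximalIdeal R ∉ minimalPrimes R := by
      intro hmin
      refine hdim ?_
      rw [← IsLocalRing.maximalIdeal_height_eq_ringKrullDim, Ideal.height_eq_zero_iff.2 hmin]
      rfl
    have hav : ∃ x ∈ maximalIdeal R, x ∉ maximalIdeal R ^ 2 ∧
        ∀ P ∈ minimalPrimes R, x ∉ P := by
      by_contra! hcon
      have hfin : (insert (maximalIdeal R ^ 2) (minimalPrimes R)).Finite :=
        (minimalPrimes.finite_of_isNoetherianRing R).insert _
      have hsub : (maximalIdeal R : Set R) ⊆
          ⋃ I ∈ insert (maximalIdeal R ^ 2) (minimalPrimes R), (I : Set R) := by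
        intro x hx
        by_cases hx2 : x ∈ maximalIdeal R ^ 2
        · exact Set.mem_biUnion (Set.mem_insert _ _) hx2
        · obtain ⟨P, hP, hxP⟩ := hcon x hx hx2
          exact Set.mem_biUnion (Set.mem_insert_of_mem _ hP) hxP
      obtain ⟨I, hI, hle⟩ := (Ideal.subset_union_prime_finite hfin (f := id)
        (maximalIdeal R ^ 2) (maximalIdeal R ^ 2) (fun I hI h _ =>
          ((Set.mem_insert_iff.1 hI).resolve_left h).1.1)).1 hsub
      rcases hI with rfl | hI
      · have hbot : maximalIdeal R = ⊥ := by
          refine Submodule.eq_bot_of_le_smul_of_le_jacobson_bot (maximalIdeal R) _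
            (IsNoetherian.noetherian _) ?_ (IsLocalRing.maximalIdeal_le_jacobson _)
          simpa [pow_two] using hle
        exact hdim (ringKrullDim_eq_zero_of_isField
          (IsLocalRing.isField_iff_maximalIdeal_eq.2 hbot))
      · have := hI.1.1
        have heq : maximalIdeal R = I := le_antisymm hle (IsLocalRing.le_maximalIdeal this.ne_top)
        exact hnm (heq ▸ hI)
    obtain ⟨x, hx, hx2, hxP⟩ := hav
    obtain ⟨t, ht, hspan⟩ := exists_span_insert_erase_eq_maximalIdeal s hs x hx hx2
    have hcard : (insert x (s.erase t)).card ≤ s.card := by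
      refine (Finset.card_insert_le _ _).trans ?_
      rw [Finset.card_erase_of_mem ht]
      omega
    obtain ⟨_, hq1, hq2⟩ := quotient_span_regular (insert x (s.erase t)) {x} (by simp) hspan
      ((Nat.cast_le.2 hcard).trans hd)
    have hc : (insert x (s.erase t) \ {x}).card ≤ n := by
      rw [Finset.card_sdiff_of_subset (by simp), Finset.card_singleton]
      omega
    have hdom := ih _ _ (Finset.card_image_le.trans hc) hq1
      ((Nat.cast_le.2 Finset.card_image_le).trans hq2)
    have hprime : (Ideal.span ((({x} : Finset R)) : Set R)).IsPrime :=
      (Ideal.Quotient.isDomain_iff_prime _).1 hdom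
    rw [Finset.coe_singleton] at hprime
    obtain ⟨P, hP, hPx⟩ := Ideal.exists_minimalPrimes_le (bot_le : ⊥ ≤ Ideal.span {x})
    have hPp : P.IsPrime := hP.1.1
    have hbot : P = ⊥ := by
      refine Submodule.eq_bot_of_le_smul_of_le_jacobson_bot (maximalIdeal R) _
        (IsNoetherian.noetherian _) ?_ (IsLocalRing.maximalIdeal_le_jacobson _)
      intro p hp
      obtain ⟨b, rfl⟩ := Ideal.mem_span_singleton'.1 (hPx hp)
      rw [mul_comm]
      exact Ideal.mul_mem_mul hx ((hPp.mem_or_mem hp).resolve_right (hxP P hP))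
    subst hbot
    exact IsDomain.of_bot_isPrime R

/-- Multiplication by an element of `m \ m²` raises the `m`-adic order by exactly one. -/
lemma mem_maximalIdeal_pow_of_mul_mem {R : Type*} [CommRing R] [IsLocalRing R]
    [IsNoetherianRing R] (s : Finset R) (hs : Ideal.span (s : Set R) = maximalIdeal R)
    (hd : (s.card : WithBot ℕ∞) ≤ ringKrullDim R)
    (x : R) (hx : x ∈ maximalIdeal R) (hx2 : x ∉ maximalIdeal R ^ 2) (k : ℕ) (a : R)
    (h : x * a ∈ maximalIdeal R ^ (k + 1)) : a ∈ maximalIdeal R ^ k := by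
  classical
  obtain ⟨t, ht, hspan⟩ := exists_span_insert_erase_eq_maximalIdeal s hs x hx hx2
  set Y := s.erase t with hY
  have hYcard : Y.card + 1 = s.card := Finset.card_erase_add_one ht
  have hcard : (insert x Y).card ≤ s.card := (Finset.card_insert_le _ _).trans hYcard.le
  have hd' : ((insert x Y).card : WithBot ℕ∞) ≤ ringKrullDim R := (Nat.cast_le.2 hcard).trans hd
  have hxY : x ∉ Y := by
    intro hxY
    rw [Finset.insert_eq_of_mem hxY] at hspan
    have h1 := hd.trans (ringKrullDim_le_card_of_span_eq_maximalIdeal Y hspan)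
    have h2 : s.card ≤ Y.card := by exact_mod_cast h1
    omega
  have key := mem_span_pow_sup_of_mul_mem (insert x Y) (by
    intro A hA y hy hyA b hb
    obtain ⟨_, hq1, hq2⟩ := quotient_span_regular (insert x Y) A hA hspan hd'
    have hdom := isDomain_of_card_le_ringKrullDim _ _ _ le_rfl hq1
      ((Nat.cast_le.2 Finset.card_image_le).trans hq2)
    have hprime : (Ideal.span (A : Set R)).IsPrime := (Ideal.Quotient.isDomain_iff_prime _).1 hdom
    refine (hprime.mem_or_mem hb).resolve_left fun hyspan => ?_
    have hgen : Ideal.span (((insert x Y).erase y : Finset R) : Set R) = maximalIdeal R := by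
      rw [← hspan]
      refine le_antisymm (Ideal.span_mono (Finset.coe_subset.2 (Finset.erase_subset _ _))) ?_
      rw [Ideal.span_le]
      intro z hz
      by_cases hzy : z = y
      · subst hzy
        refine Ideal.span_mono (fun w hw => ?_) hyspan
        exact Finset.mem_erase.2 ⟨fun h => hyA (h ▸ hw), hA hw⟩
      · exact Ideal.subset_span (Finset.mem_erase.2 ⟨hzy, hz⟩)
    have h1 := hd'.trans (ringKrullDim_le_card_of_span_eq_maximalIdeal _ hgen)
    have h2 : (insert x Y).card ≤ ((insert x Y).erase y).card := by exact_mod_cast h1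
    have h3 := Finset.card_erase_lt_of_mem hy
    omega) Y (Finset.subset_insert _ _) ∅ (Finset.empty_subset _) (Finset.disjoint_empty_right _)
    x (Finset.mem_insert_self _ _) (Finset.notMem_empty _) hxY
  simp only [Finset.coe_empty, Ideal.span_empty, sup_bot_eq] at key
  have hYm : Ideal.span (Y : Set R) ≤ maximalIdeal R :=
    hspan ▸ Ideal.span_mono (Finset.coe_subset.2 (Finset.subset_insert _ _))
  have hpow : maximalIdeal R ^ (k + 1) =
      Ideal.span {x} * maximalIdeal R ^ k ⊔ Ideal.span (Y : Set R) ^ (k + 1) := by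
    rw [← hspan, Finset.coe_insert, Ideal.span_insert]
    exact sup_pow_succ_eq _ _ _
  rw [hpow] at h
  obtain ⟨xb, hxb, c, hc, hsum⟩ := Submodule.mem_sup.1 h
  obtain ⟨b, hb, rfl⟩ := Ideal.mem_span_singleton_mul.1 hxb
  have h1 : a - b ∈ Ideal.span (Y : Set R) ^ (k + 1) := by
    refine key (k + 1) _ ?_
    convert hc using 1
    linear_combination -hsum
  have h2 : a - b ∈ maximalIdeal R ^ k :=
    Ideal.pow_le_pow_right k.le_succ (Ideal.pow_right_mono hYm _ h1)
  simpa using add_mem h2 hb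

/-- Every element of `R[I/x]` is of the form `b / x ^ n` with `b ∈ I ^ n`. -/
lemma exists_mul_pow_eq_of_mem_adjoin {R K : Type*} [CommRing R] [Field K] [Algebra R K]
    (I : Ideal R) (x : R) (hx : algebraMap R K x ≠ 0) (z : K)
    (hz : z ∈ Algebra.adjoin R {z : K | ∃ a ∈ I, z = algebraMap R K a / algebraMap R K x})
    (hxI : x ∈ I) :
    ∃ n : ℕ, ∃ b ∈ I ^ n, z * algebraMap R K x ^ n = algebraMap R K b := by
  induction hz using Algebra.adjoin_induction with
  | mem z hz =>
    obtain ⟨a, ha, rfl⟩ := hz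
    exact ⟨1, a, by simpa using ha, by rw [pow_one, div_mul_cancel₀ _ hx]⟩
  | algebraMap r => exact ⟨0, r, by simp, by simp⟩
  | add z w _ _ hz hw =>
    obtain ⟨n, b, hb, hzb⟩ := hz
    obtain ⟨l, c, hc, hwc⟩ := hw
    refine ⟨n + l, b * x ^ l + c * x ^ n, add_mem ?_ ?_, ?_⟩
    · rw [pow_add]
      exact Ideal.mul_mem_mul hb (Ideal.pow_mem_pow hxI l)
    · rw [add_comm n l, pow_add]
      exact Ideal.mul_mem_mul hc (Ideal.pow_mem_pow hxI n)
    · rw [map_add, map_mul, map_mul, ← hzb, ← hwc, map_pow, map_pow]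
      ring
  | mul z w _ _ hz hw =>
    obtain ⟨n, b, hb, hzb⟩ := hz
    obtain ⟨l, c, hc, hwc⟩ := hw
    refine ⟨n + l, b * c, ?_, ?_⟩
    · rw [pow_add]
      exact Ideal.mul_mem_mul hb hc
    · rw [map_mul, ← hzb, ← hwc]
      ring

/-- Let `(R, m)` be a local regular domain, let `x ∈ m \ m²`, and let
`S = R[m/x]` be the subring of the fraction field of `R` generated by `R` and the elements
`a/x`, `a ∈ m`.  Then for every `k ∈ ℕ` one has `x^k S ∩ R = m^k S ∩ R = m^k`. -/
theorem pow_comap_eq (R : Type*) [CommRing R] [IsDomain R] [IsLocalRing R]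
    (hreg : IsRegLoc R)
    (x : R) (hx : x ∈ maximalIdeal R) (hx2 : x ∉ (maximalIdeal R) ^ 2)
    (S : Subalgebra R (FractionRing R))
    (hS : S = Algebra.adjoin R {z : FractionRing R | ∃ a ∈ maximalIdeal R,
      z = algebraMap R (FractionRing R) a / algebraMap R (FractionRing R) x})
    (k : ℕ) :
    Ideal.comap (algebraMap R S) (Ideal.span {(algebraMap R S x) ^ k}) = (maximalIdeal R) ^ k ∧
    Ideal.comap (algebraMap R S) ((Ideal.map (algebraMap R S) (maximalIdeal R)) ^ k) =
      (maximalIdeal R) ^ k := by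
  obtain ⟨-, _, s, hs, hd⟩ := hreg
  rw [nuIdeal_eq_maximalIdeal] at hs
  have hx0 : algebraMap R (FractionRing R) x ≠ 0 := by
    rw [Ne, FaithfulSMul.algebraMap_eq_zero_iff]
    rintro rfl
    exact hx2 (zero_mem _)
  have hmap : Ideal.map (algebraMap R S) (maximalIdeal R) = Ideal.span {algebraMap R S x} := by
    refine le_antisymm (Ideal.map_le_iff_le_comap.2 fun a ha => ?_) ?_
    · refine Ideal.mem_span_singleton'.2
        ⟨⟨algebraMap R (FractionRing R) a / algebraMap R (FractionRing R) x, ?_⟩, ?_⟩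
      · rw [hS]
        exact Algebra.subset_adjoin ⟨a, ha, rfl⟩
      · exact Subtype.ext (div_mul_cancel₀ _ hx0)
    · rw [Ideal.span_singleton_le_iff_mem]
      exact Ideal.mem_map_of_mem _ hx
  have hcancel : ∀ (n : ℕ) (a : R), x ^ n * a ∈ maximalIdeal R ^ (k + n) →
      a ∈ maximalIdeal R ^ k := by
    intro n
    induction n with
    | zero => intro a h; simpa using h
    | succ n ih =>
      intro a h
      refine ih a (mem_maximalIdeal_pow_of_mul_mem s hs hd.le x hx hx2 (k + n) _ ?_)
      rwa [← mul_assoc, ← pow_succ']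
  rw [hmap, Ideal.span_singleton_pow, and_self]
  refine le_antisymm (fun r hr => ?_) ?_
  · obtain ⟨z, hz⟩ := Ideal.mem_span_singleton'.1 (Ideal.mem_comap.1 hr)
    have hzS : (z : FractionRing R) ∈ Algebra.adjoin R {z : FractionRing R |
        ∃ a ∈ maximalIdeal R,
          z = algebraMap R (FractionRing R) a / algebraMap R (FractionRing R) x} :=
      hS ▸ z.2
    obtain ⟨n, b, hb, hzb⟩ := exists_mul_pow_eq_of_mem_adjoin _ x hx0 _ hzS hx
    have hz' : (z : FractionRing R) * algebraMap R (FractionRing R) x ^ k =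
        algebraMap R (FractionRing R) r := congrArg Subtype.val hz
    refine hcancel n r ?_
    have heq : x ^ n * r = x ^ k * b := by
      apply FaithfulSMul.algebraMap_injective R (FractionRing R)
      rw [map_mul, map_mul, ← hzb, ← hz', map_pow, map_pow]
      ring
    rw [heq, pow_add]
    exact Ideal.mul_mem_mul (Ideal.pow_mem_pow hx k) hb
  · rw [← Ideal.span_singleton_pow, ← hmap, ← Ideal.map_pow]
    exact Ideal.le_comap_map

end
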